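/- For every γ > 0, the normalized Plummer density f(x) = (3/(4πγ³)) (1 + |x|²/γ²)^{−5/2} on ℝ³ saturates the diagonal Hardy–Littlewood–Sobolev inequality with D = 3, λ = 1: ∬_{ℝ³×ℝ³} f(x) f(y) |x−y|^{−1} dx dy = C(3,1) ‖f‖_{6/5}², where C(3,1) = π^{1/2} Γ(1)/Γ(5/2) · (Γ(3/2)/Γ(3))^{−2/3}. -/

import Mathlib

open MeasureTheory

/-- The sharp diagonal Hardy–Littlewood–Sobolev constant for `D = 3`, `λ = 1`:
`C(3,1) = π^{1/2} Γ(1)/Γ(5/2) · (Γ(3/2)/Γ(3))^{−2/3}`. -/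
noncomputable def C31 : ℝ :=
  Real.pi ^ ((1 : ℝ) / 2) * (Real.Gamma 1 / Real.Gamma (5 / 2)) *
    (Real.Gamma (3 / 2) / Real.Gamma 3) ^ (-(2 : ℝ) / 3)

/-- The normalized Plummer density `f(x) = (3/(4πγ³)) (1 + |x|²/γ²)^{−5/2}`
with Plummer radius `γ > 0`. -/
noncomputable def plummerDensity (γ : ℝ) (x : EuclideanSpace ℝ (Fin 3)) : ℝ :=
  (3 / (4 * Real.pi * γ ^ 3)) * (1 + ‖x‖ ^ 2 / γ ^ 2) ^ (-(5 : ℝ) / 2)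

theorem lintegral_rpow_mul_exp_neg_mul_Ioi {a r : ℝ} (ha : 0 < a) (hr : 0 < r) :
    ∫⁻ t in Set.Ioi (0 : ℝ), ENNReal.ofReal (t ^ (a - 1) * Real.exp (-(r * t))) =
      ENNReal.ofReal (r ^ (-a) * Real.Gamma a) := by
  have h := Real.integral_rpow_mul_exp_neg_mul_Ioi ha hr
  have hG := Real.Gamma_pos_of_pos ha
  have hint : IntegrableOn (fun t : ℝ ↦ t ^ (a - 1) * Real.exp (-(r * t))) (Set.Ioi 0) :=
    .of_integral_ne_zero (by rw [h]; positivity)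
  rw [← ofReal_integral_eq_lintegral_ofReal hint, h, one_div, Real.inv_rpow hr.le,
    Real.rpow_neg hr.le]
  refine (ae_restrict_iff' measurableSet_Ioi).mpr (ae_of_all _ fun t (ht : 0 < t) ↦ ?_)
  simp only [Pi.zero_apply]
  positivity

theorem lintegral_exp_neg_mul_Ioi {b : ℝ} (hb : 0 < b) (c : ℝ) :
    ∫⁻ s in Set.Ioi c, ENNReal.ofReal (Real.exp (-(b * s))) =
      ENNReal.ofReal (b⁻¹ * Real.exp (-(b * c))) := by
  have h := integral_exp_mul_Ioi (neg_lt_zero.mpr hb) c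
  have hint : IntegrableOn (fun s : ℝ ↦ Real.exp (-b * s)) (Set.Ioi c) :=
    .of_integral_ne_zero (by rw [h, neg_div_neg_eq]; positivity)
  simp only [← neg_mul]
  rw [← ofReal_integral_eq_lintegral_ofReal hint (ae_of_all _ fun _ ↦ (Real.exp_pos _).le), h,
    neg_div_neg_eq, div_eq_inv_mul]

theorem lintegral_exp_neg_mul_sq_norm {c : ℝ} (hc : 0 < c) :
    ∫⁻ y : EuclideanSpace ℝ (Fin 3), ENNReal.ofReal (Real.exp (-(c * ‖y‖ ^ 2))) =
      ENNReal.ofReal (Real.pi ^ (3 / 2 : ℝ) * c ^ (-(3 / 2 : ℝ))) := by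
  have h := GaussianFourier.integral_rexp_neg_mul_sq_norm (V := EuclideanSpace ℝ (Fin 3)) hc
  have hint : Integrable (fun y : EuclideanSpace ℝ (Fin 3) ↦ Real.exp (-c * ‖y‖ ^ 2)) :=
    .of_integral_ne_zero (by rw [h]; positivity)
  simp only [← neg_mul]
  rw [← ofReal_integral_eq_lintegral_ofReal hint (ae_of_all _ fun _ ↦ (Real.exp_pos _).le), h,
    finrank_euclideanSpace_fin, Real.div_rpow Real.pi_pos.le hc.le, Real.rpow_neg hc.le]
  norm_num [div_eq_mul_inv]

theorem mul_sq_norm_add_mul_sq_norm_sub {V : Type*} [NormedAddCommGroup V] [InnerProductSpace ℝ V]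
    {s t : ℝ} (h : s + t ≠ 0) (x y : V) :
    s * ‖y‖ ^ 2 + t * ‖x - y‖ ^ 2 =
      (s + t) * ‖y - (t / (s + t)) • x‖ ^ 2 + s * t / (s + t) * ‖x‖ ^ 2 := by
  rw [norm_sub_sq_real, norm_sub_sq_real, inner_smul_right, norm_smul, mul_pow, Real.norm_eq_abs,
    sq_abs, real_inner_comm]
  field_simp
  ring

theorem lintegral_exp_mul_exp_sub {s t : ℝ} (hs : 0 < s) (ht : 0 < t)
    (x : EuclideanSpace ℝ (Fin 3)) :
    ∫⁻ y, ENNReal.ofReal (Real.exp (-(s * ‖y‖ ^ 2 + t * ‖x - y‖ ^ 2))) =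
      ENNReal.ofReal (Real.pi ^ (3 / 2 : ℝ) *
        ((s + t) ^ (-(3 / 2 : ℝ)) * Real.exp (-(s * t / (s + t) * ‖x‖ ^ 2)))) := by
  have hst : 0 < s + t := add_pos hs ht
  simp_rw [mul_sq_norm_add_mul_sq_norm_sub hst.ne' x, neg_add, Real.exp_add,
    ENNReal.ofReal_mul (Real.exp_pos _).le]
  rw [lintegral_mul_const' _ _ ENNReal.ofReal_ne_top,
    lintegral_sub_right_eq_self (fun y ↦ ENNReal.ofReal (Real.exp (-((s + t) * ‖y‖ ^ 2)))),
    lintegral_exp_neg_mul_sq_norm hst, ← ENNReal.ofReal_mul (by positivity), mul_assoc]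

theorem lintegral_lintegral_triangle_swap {F : ℝ → ℝ → ENNReal}
    (hF : Measurable (Function.uncurry F)) :
    ∫⁻ s in Set.Ioi (0 : ℝ), ∫⁻ u in Set.Ioo 0 s, F s u =
      ∫⁻ u in Set.Ioi (0 : ℝ), ∫⁻ s in Set.Ioi u, F s u := by
  have hT : MeasurableSet {p : ℝ × ℝ | 0 < p.2 ∧ p.2 < p.1} :=
    (measurableSet_lt measurable_const measurable_snd).inter
      (measurableSet_lt measurable_snd measurable_fst)
  have key := lintegral_lintegral_swap (μ := (volume : Measure ℝ)) (ν := (volume : Measure ℝ))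
    (f := fun s u ↦ {p : ℝ × ℝ | 0 < p.2 ∧ p.2 < p.1}.indicator (Function.uncurry F) (s, u))
    (hF.indicator hT).aemeasurable
  simp only [← lintegral_indicator measurableSet_Ioi, ← lintegral_indicator measurableSet_Ioo]
  convert key using 3 with s u
  · by_cases hs : 0 < s
    · simp only [Set.mem_Ioi, hs, Set.indicator_of_mem]
      exact lintegral_congr fun u ↦ by simp [Set.indicator, Function.uncurry]
    · rw [Set.indicator_of_notMem (by simpa using hs)]
      symm
      rw [lintegral_eq_zero_of_ae_eq_zero]
      refine ae_of_all _ fun u ↦ Set.indicator_of_notMem ?_ _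
      rintro ⟨h0, h1⟩
      exact hs (h0.trans h1)
  · by_cases hu : 0 < u
    · simp [hu, Set.indicator, Function.uncurry]
    · simp [hu, Set.indicator]

theorem lintegral_Ioi_eq_lintegral_Ioo {s : ℝ} (hs : 0 < s) (a : ℝ) :
    ∫⁻ t in Set.Ioi (0 : ℝ), ENNReal.ofReal (s ^ (3 / 2 : ℝ) * (t ^ (-(1 / 2 : ℝ)) *
        ((s + t) ^ (-(3 / 2 : ℝ)) * Real.exp (-(s * t / (s + t) * a))))) =
      ∫⁻ u in Set.Ioo 0 s, ENNReal.ofReal (u ^ (-(1 / 2 : ℝ)) * Real.exp (-(a * u))) := by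
  have himg : (fun u ↦ s * u / (s - u)) '' Set.Ioo 0 s = Set.Ioi 0 := by
    ext t
    constructor
    · rintro ⟨u, ⟨h0, h1⟩, rfl⟩
      exact div_pos (mul_pos hs h0) (sub_pos.mpr h1)
    · intro (ht : 0 < t)
      have hst : 0 < s + t := add_pos hs ht
      refine ⟨s * t / (s + t), ⟨by positivity, ?_⟩, ?_⟩
      · rw [div_lt_iff₀ hst]; nlinarith
      · have : s - s * t / (s + t) = s ^ 2 / (s + t) := by field_simp; ring
        simp only [this]
        field_simp
  have hinj : Set.InjOn (fun u ↦ s * u / (s - u)) (Set.Ioo 0 s) := by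
    intro u hu v hv h
    have hu' : s - u ≠ 0 := (sub_pos.mpr hu.2).ne'
    have hv' : s - v ≠ 0 := (sub_pos.mpr hv.2).ne'
    simp only at h
    rw [div_eq_div_iff hu' hv'] at h
    have : s * s * (u - v) = 0 := by linarith
    simpa [hs.ne', sub_eq_zero] using this
  have hder : ∀ u ∈ Set.Ioo 0 s, HasDerivWithinAt (fun u ↦ s * u / (s - u))
      (s ^ 2 / (s - u) ^ 2) (Set.Ioo 0 s) u := by
    intro u hu
    have hu' : s - u ≠ 0 := (sub_pos.mpr hu.2).ne'
    have := (((hasDerivAt_id u).const_mul s).div ((hasDerivAt_id u).const_sub s) hu')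
    refine (this.congr_deriv ?_).hasDerivWithinAt
    simp only [id]
    field_simp
    ring
  rw [← himg, lintegral_image_eq_lintegral_abs_deriv_mul measurableSet_Ioo hder hinj]
  refine setLIntegral_congr_fun measurableSet_Ioo fun u ⟨h0, h1⟩ ↦ ?_
  have hsu : 0 < s - u := sub_pos.mpr h1
  rw [← ENNReal.ofReal_mul (abs_nonneg _), abs_of_pos (by positivity)]
  have e1 : s + s * u / (s - u) = s ^ 2 / (s - u) := by field_simp; ring
  have e2 : s * (s * u / (s - u)) / (s ^ 2 / (s - u)) = u := by field_simp
  rw [e1, e2, mul_comm u a]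
  congr 1
  simp only [← mul_assoc]
  congr 1
  rw [Real.div_rpow (by positivity) hsu.le, Real.div_rpow (by positivity) hsu.le,
    Real.mul_rpow hs.le h0.le, ← Real.rpow_natCast s 2, ← Real.rpow_mul hs.le,
    ← Real.rpow_natCast (s - u) 2]
  have k1 : s ^ ((2 : ℕ) : ℝ) * s ^ (3 / 2 : ℝ) * s ^ (-(1 / 2 : ℝ)) *
      s ^ (((2 : ℕ) : ℝ) * -(3 / 2 : ℝ)) = 1 := by
    rw [← Real.rpow_add hs, ← Real.rpow_add hs, ← Real.rpow_add hs]; norm_num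
  have k2 : (s - u) ^ ((2 : ℕ) : ℝ) * (s - u) ^ (-(1 / 2 : ℝ)) * (s - u) ^ (-(3 / 2 : ℝ)) = 1 := by
    rw [← Real.rpow_add hsu, ← Real.rpow_add hsu]; norm_num
  calc _ = (s ^ ((2 : ℕ) : ℝ) * s ^ (3 / 2 : ℝ) * s ^ (-(1 / 2 : ℝ)) *
      s ^ (((2 : ℕ) : ℝ) * -(3 / 2 : ℝ))) * u ^ (-(1 / 2 : ℝ)) /
      ((s - u) ^ ((2 : ℕ) : ℝ) * (s - u) ^ (-(1 / 2 : ℝ)) * (s - u) ^ (-(3 / 2 : ℝ))) := by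
        field_simp
    _ = _ := by rw [k1, k2]; simp

theorem lintegral_rpow_sq_norm_mul_inv_norm_sub {b : ℝ} (hb : 0 < b)
    (x : EuclideanSpace ℝ (Fin 3)) :
    ∫⁻ y, ENNReal.ofReal ((b + ‖y‖ ^ 2) ^ (-(5 / 2 : ℝ)) * ‖x - y‖ ^ (-(1 : ℝ))) =
      ENNReal.ofReal (4 * Real.pi / (3 * b) * (b + ‖x‖ ^ 2) ^ (-(1 / 2 : ℝ))) := by
  have hG : 0 < Real.Gamma (5 / 2) * Real.Gamma (1 / 2) :=
    mul_pos (Real.Gamma_pos_of_pos (by norm_num)) (Real.Gamma_pos_of_pos (by norm_num))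
  have hae : ∀ᵐ y : EuclideanSpace ℝ (Fin 3),
      ENNReal.ofReal (Real.Gamma (5 / 2) * Real.Gamma (1 / 2)) *
        ENNReal.ofReal ((b + ‖y‖ ^ 2) ^ (-(5 / 2 : ℝ)) * ‖x - y‖ ^ (-(1 : ℝ))) =
      ∫⁻ s in Set.Ioi (0 : ℝ), ∫⁻ t in Set.Ioi (0 : ℝ),
        ENNReal.ofReal (s ^ (5 / 2 - 1 : ℝ) * Real.exp (-((b + ‖y‖ ^ 2) * s))) *
          ENNReal.ofReal (t ^ (1 / 2 - 1 : ℝ) * Real.exp (-(‖x - y‖ ^ 2 * t))) := by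
    filter_upwards [compl_mem_ae_iff.mpr (measure_singleton x)] with y hy
    have hxy : 0 < ‖x - y‖ := norm_pos_iff.mpr (sub_ne_zero.mpr (Ne.symm hy))
    rw [lintegral_lintegral_mul (by fun_prop) (by fun_prop),
      lintegral_rpow_mul_exp_neg_mul_Ioi (by norm_num) (by positivity),
      lintegral_rpow_mul_exp_neg_mul_Ioi (by norm_num) (by positivity),
      ← ENNReal.ofReal_mul hG.le, ← ENNReal.ofReal_mul
        (mul_nonneg (by positivity) (Real.Gamma_pos_of_pos (by norm_num)).le),
      ← Real.rpow_natCast ‖x - y‖ 2, ← Real.rpow_mul hxy.le]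
    norm_num
    ring_nf
  have hinner : ∀ s ∈ Set.Ioi (0 : ℝ), (∫⁻ t in Set.Ioi (0 : ℝ),
      ∫⁻ y : EuclideanSpace ℝ (Fin 3),
        ENNReal.ofReal (s ^ (5 / 2 - 1 : ℝ) * Real.exp (-((b + ‖y‖ ^ 2) * s))) *
          ENNReal.ofReal (t ^ (1 / 2 - 1 : ℝ) * Real.exp (-(‖x - y‖ ^ 2 * t)))) =
      ENNReal.ofReal (Real.pi ^ (3 / 2 : ℝ)) * ∫⁻ u in Set.Ioo 0 s,
        ENNReal.ofReal (u ^ (-(1 / 2 : ℝ)) * Real.exp (-(‖x‖ ^ 2 * u))) *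
          ENNReal.ofReal (Real.exp (-(b * s))) := by
    intro s (hs : 0 < s)
    rw [lintegral_mul_const' _ _ ENNReal.ofReal_ne_top, ← lintegral_Ioi_eq_lintegral_Ioo hs,
      ← lintegral_mul_const' _ _ ENNReal.ofReal_ne_top,
      ← lintegral_const_mul' _ _ ENNReal.ofReal_ne_top]
    refine setLIntegral_congr_fun measurableSet_Ioi fun t (ht : 0 < t) ↦ ?_
    have hsplit : ∀ y : EuclideanSpace ℝ (Fin 3),
        ENNReal.ofReal (s ^ (5 / 2 - 1 : ℝ) * Real.exp (-((b + ‖y‖ ^ 2) * s))) *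
          ENNReal.ofReal (t ^ (1 / 2 - 1 : ℝ) * Real.exp (-(‖x - y‖ ^ 2 * t))) =
        ENNReal.ofReal (s ^ (3 / 2 : ℝ) * t ^ (-(1 / 2 : ℝ)) * Real.exp (-(b * s))) *
          ENNReal.ofReal (Real.exp (-(s * ‖y‖ ^ 2 + t * ‖x - y‖ ^ 2))) := by
      intro y
      rw [← ENNReal.ofReal_mul (by positivity), ← ENNReal.ofReal_mul (by positivity)]
      have h1 : Real.exp (-((b + ‖y‖ ^ 2) * s)) * Real.exp (-(‖x - y‖ ^ 2 * t)) =
          Real.exp (-(b * s)) * Real.exp (-(s * ‖y‖ ^ 2 + t * ‖x - y‖ ^ 2)) := by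
        rw [← Real.exp_add, ← Real.exp_add]; ring_nf
      norm_num only
      congr 1
      linear_combination s ^ (3 / 2 : ℝ) * t ^ (-(1 / 2) : ℝ) * h1
    simp_rw [hsplit]
    rw [lintegral_const_mul' _ _ ENNReal.ofReal_ne_top, lintegral_exp_mul_exp_sub hs ht,
      ← ENNReal.ofReal_mul (by positivity), ← ENNReal.ofReal_mul (by positivity),
      ← ENNReal.ofReal_mul (by positivity)]
    ring_nf
  have hne : ENNReal.ofReal (Real.Gamma (5 / 2) * Real.Gamma (1 / 2)) ≠ 0 := by
    simpa using hG
  rw [← ENNReal.mul_right_inj hne ENNReal.ofReal_ne_top,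
    ← lintegral_const_mul' _ _ ENNReal.ofReal_ne_top, lintegral_congr_ae hae,
    lintegral_lintegral_swap (by
      refine (Measurable.lintegral_prod_right' (f := fun q : (EuclideanSpace ℝ (Fin 3) × ℝ) × ℝ ↦
        ENNReal.ofReal (q.1.2 ^ (5 / 2 - 1 : ℝ) * Real.exp (-((b + ‖q.1.1‖ ^ 2) * q.1.2))) *
          ENNReal.ofReal (q.2 ^ (1 / 2 - 1 : ℝ) * Real.exp (-(‖x - q.1.1‖ ^ 2 * q.2))))
        ?_).aemeasurable
      fun_prop)]
  have hswap : ∀ s : ℝ, (∫⁻ y : EuclideanSpace ℝ (Fin 3), ∫⁻ t in Set.Ioi (0 : ℝ),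
        ENNReal.ofReal (s ^ (5 / 2 - 1 : ℝ) * Real.exp (-((b + ‖y‖ ^ 2) * s))) *
          ENNReal.ofReal (t ^ (1 / 2 - 1 : ℝ) * Real.exp (-(‖x - y‖ ^ 2 * t)))) = _ :=
    fun s ↦ lintegral_lintegral_swap (by unfold Function.uncurry; fun_prop)
  simp_rw [hswap]
  rw [setLIntegral_congr_fun measurableSet_Ioi hinner,
    lintegral_const_mul' _ _ ENNReal.ofReal_ne_top,
    lintegral_lintegral_triangle_swap (by unfold Function.uncurry; fun_prop)]
  have hlast : ∀ u : ℝ, (∫⁻ s in Set.Ioi u,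
      ENNReal.ofReal (u ^ (-(1 / 2 : ℝ)) * Real.exp (-(‖x‖ ^ 2 * u))) *
          ENNReal.ofReal (Real.exp (-(b * s)))) =
      ENNReal.ofReal b⁻¹ *
        ENNReal.ofReal (u ^ (1 / 2 - 1 : ℝ) * Real.exp (-((b + ‖x‖ ^ 2) * u))) := by
    intro u
    rw [lintegral_const_mul' _ _ ENNReal.ofReal_ne_top, lintegral_exp_neg_mul_Ioi hb,
      ← ENNReal.ofReal_mul' (by positivity), ← ENNReal.ofReal_mul (by positivity), add_mul,
      neg_add, Real.exp_add]
    norm_num only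
    ring_nf
  simp_rw [hlast]
  rw [lintegral_const_mul' _ _ ENNReal.ofReal_ne_top,
    lintegral_rpow_mul_exp_neg_mul_Ioi (by norm_num) (by positivity),
    ← ENNReal.ofReal_mul (by positivity), ← ENNReal.ofReal_mul (by positivity),
    ← ENNReal.ofReal_mul hG.le]
  congr 1
  have h52 : Real.Gamma (5 / 2) = 3 / 4 * √Real.pi := by
    rw [show (5 / 2 : ℝ) = 3 / 2 + 1 by norm_num, Real.Gamma_add_one (by norm_num),
      show (3 / 2 : ℝ) = 1 / 2 + 1 by norm_num, Real.Gamma_add_one (by norm_num),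
      Real.Gamma_one_half_eq]
    ring
  have hpi : Real.pi ^ (3 / 2 : ℝ) = Real.pi * √Real.pi := by
    rw [show (3 / 2 : ℝ) = 1 + 1 / 2 by norm_num, Real.rpow_add Real.pi_pos, Real.rpow_one,
      Real.sqrt_eq_rpow]
  rw [h52, hpi, Real.Gamma_one_half_eq]
  field_simp

theorem lintegral_rpow_neg_three_sq_norm {b : ℝ} (hb : 0 < b) :
    ∫⁻ x : EuclideanSpace ℝ (Fin 3), ENNReal.ofReal ((b + ‖x‖ ^ 2) ^ (-(3 : ℝ))) =
      ENNReal.ofReal (Real.pi ^ 2 / 4 * b ^ (-(3 / 2 : ℝ))) := by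
  have hG : Real.Gamma 3 = 2 := by
    rw [show (3 : ℝ) = 2 + 1 by norm_num, Real.Gamma_add_one (by norm_num), Real.Gamma_two]
    norm_num
  have h2 : ENNReal.ofReal 2 ≠ 0 := by simp
  rw [← ENNReal.mul_right_inj h2 ENNReal.ofReal_ne_top,
    ← lintegral_const_mul' _ _ ENNReal.ofReal_ne_top]
  have hrep : ∀ x : EuclideanSpace ℝ (Fin 3),
      ENNReal.ofReal 2 * ENNReal.ofReal ((b + ‖x‖ ^ 2) ^ (-(3 : ℝ))) =
      ∫⁻ s in Set.Ioi (0 : ℝ),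
        ENNReal.ofReal (s ^ (3 - 1 : ℝ) * Real.exp (-((b + ‖x‖ ^ 2) * s))) := by
    intro x
    rw [lintegral_rpow_mul_exp_neg_mul_Ioi (by norm_num) (by positivity), hG,
      ENNReal.ofReal_mul (by positivity), mul_comm]
  simp_rw [hrep]
  rw [lintegral_lintegral_swap (by unfold Function.uncurry; fun_prop)]
  have hinner : ∀ s ∈ Set.Ioi (0 : ℝ), (∫⁻ x : EuclideanSpace ℝ (Fin 3),
      ENNReal.ofReal (s ^ (3 - 1 : ℝ) * Real.exp (-((b + ‖x‖ ^ 2) * s)))) =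
      ENNReal.ofReal (Real.pi ^ (3 / 2 : ℝ)) *
        ENNReal.ofReal (s ^ (3 / 2 - 1 : ℝ) * Real.exp (-(b * s))) := by
    intro s (hs : 0 < s)
    have hsplit : ∀ x : EuclideanSpace ℝ (Fin 3),
        ENNReal.ofReal (s ^ (3 - 1 : ℝ) * Real.exp (-((b + ‖x‖ ^ 2) * s))) =
        ENNReal.ofReal (s ^ (3 - 1 : ℝ) * Real.exp (-(b * s))) *
          ENNReal.ofReal (Real.exp (-(s * ‖x‖ ^ 2))) := by
      intro x
      rw [← ENNReal.ofReal_mul (by positivity), mul_assoc, ← Real.exp_add]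
      ring_nf
    simp_rw [hsplit]
    rw [lintegral_const_mul' _ _ ENNReal.ofReal_ne_top, lintegral_exp_neg_mul_sq_norm hs,
      ← ENNReal.ofReal_mul (by positivity), ← ENNReal.ofReal_mul (by positivity)]
    have : s ^ (3 / 2 - 1 : ℝ) = s ^ (3 - 1 : ℝ) * s ^ (-(3 / 2 : ℝ)) := by
      rw [← Real.rpow_add hs]; norm_num
    rw [this]
    ring_nf
  rw [setLIntegral_congr_fun measurableSet_Ioi hinner,
    lintegral_const_mul' _ _ ENNReal.ofReal_ne_top,
    lintegral_rpow_mul_exp_neg_mul_Ioi (by norm_num) hb,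
    ← ENNReal.ofReal_mul (by positivity), ← ENNReal.ofReal_mul (by positivity)]
  congr 1
  have h32 : Real.Gamma (3 / 2) = 1 / 2 * √Real.pi := by
    rw [show (3 / 2 : ℝ) = 1 / 2 + 1 by norm_num, Real.Gamma_add_one (by norm_num),
      Real.Gamma_one_half_eq]
  have hpi : Real.pi ^ (3 / 2 : ℝ) = Real.pi * √Real.pi := by
    rw [show (3 / 2 : ℝ) = 1 + 1 / 2 by norm_num, Real.rpow_add Real.pi_pos, Real.rpow_one,
      Real.sqrt_eq_rpow]
  rw [h32, hpi]
  linear_combination (Real.pi / 2 * b ^ (-(3 / 2 : ℝ))) * Real.mul_self_sqrt Real.pi_pos.le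

theorem plummerDensity_eq {γ : ℝ} (hγ : 0 < γ) (x : EuclideanSpace ℝ (Fin 3)) :
    plummerDensity γ x =
      3 * γ ^ 2 / (4 * Real.pi) * (γ ^ 2 + ‖x‖ ^ 2) ^ (-(5 / 2 : ℝ)) := by
  have h : 1 + ‖x‖ ^ 2 / γ ^ 2 = (γ ^ 2 + ‖x‖ ^ 2) / γ ^ 2 := by field_simp
  have h5 : (γ ^ 2) ^ (-(5 / 2 : ℝ)) = (γ ^ 5)⁻¹ := by
    rw [← Real.rpow_natCast γ 2, ← Real.rpow_mul hγ.le, ← Real.rpow_natCast γ 5,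
      ← Real.rpow_neg hγ.le]
    norm_num
  rw [plummerDensity, h, neg_div, Real.div_rpow (by positivity) (by positivity), h5]
  field_simp

theorem integral_plummerDensity_rpow {γ : ℝ} (hγ : 0 < γ) :
    ∫ x, plummerDensity γ x ^ ((6 : ℝ) / 5) =
      (3 * γ ^ 2 / (4 * Real.pi)) ^ ((6 : ℝ) / 5) * (Real.pi ^ 2 / 4 * (γ ^ 3)⁻¹) := by
  have hpi := Real.pi_pos
  have hf : ∀ x, plummerDensity γ x ^ ((6 : ℝ) / 5) =
      (3 * γ ^ 2 / (4 * Real.pi)) ^ ((6 : ℝ) / 5) * (γ ^ 2 + ‖x‖ ^ 2) ^ (-(3 : ℝ)) := by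
    intro x
    rw [plummerDensity_eq hγ, Real.mul_rpow (by positivity) (by positivity),
      ← Real.rpow_mul (by positivity)]
    norm_num
  have h3 : (γ ^ 2) ^ (-(3 / 2 : ℝ)) = (γ ^ 3)⁻¹ := by
    rw [← Real.rpow_natCast γ 2, ← Real.rpow_mul hγ.le, ← Real.rpow_natCast γ 3,
      ← Real.rpow_neg hγ.le]
    norm_num
  simp_rw [hf]
  rw [integral_const_mul, integral_eq_lintegral_of_nonneg_ae
    (ae_of_all _ fun _ ↦ by simp only [Pi.zero_apply]; positivity)
    (by measurability), lintegral_rpow_neg_three_sq_norm (by positivity),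
    ENNReal.toReal_ofReal (by positivity), h3]

theorem integral_plummerDensity_mul_plummerDensity {γ : ℝ} (hγ : 0 < γ) :
    ∫ p : EuclideanSpace ℝ (Fin 3) × EuclideanSpace ℝ (Fin 3),
        plummerDensity γ p.1 * plummerDensity γ p.2 * ‖p.1 - p.2‖ ^ (-(1 : ℝ))
        ∂(volume.prod volume) = 3 * Real.pi / (16 * γ) := by
  have hpi := Real.pi_pos
  have h3 : (γ ^ 2) ^ (-(3 / 2 : ℝ)) = (γ ^ 3)⁻¹ := by
    rw [← Real.rpow_natCast γ 2, ← Real.rpow_mul hγ.le, ← Real.rpow_natCast γ 3,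
      ← Real.rpow_neg hγ.le]
    norm_num
  have hmeas : Measurable fun p : EuclideanSpace ℝ (Fin 3) × EuclideanSpace ℝ (Fin 3) ↦
      plummerDensity γ p.1 * plummerDensity γ p.2 * ‖p.1 - p.2‖ ^ (-(1 : ℝ)) := by
    unfold plummerDensity
    fun_prop
  have hinner : ∀ x : EuclideanSpace ℝ (Fin 3),
      ∫⁻ y, ENNReal.ofReal (plummerDensity γ x * plummerDensity γ y * ‖x - y‖ ^ (-(1 : ℝ))) =
        ENNReal.ofReal ((3 * γ ^ 2 / (4 * Real.pi)) ^ 2 * (4 * Real.pi / (3 * γ ^ 2))) *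
          ENNReal.ofReal ((γ ^ 2 + ‖x‖ ^ 2) ^ (-(3 : ℝ))) := by
    intro x
    have hsplit : ∀ y : EuclideanSpace ℝ (Fin 3),
        ENNReal.ofReal (plummerDensity γ x * plummerDensity γ y * ‖x - y‖ ^ (-(1 : ℝ))) =
        ENNReal.ofReal ((3 * γ ^ 2 / (4 * Real.pi)) ^ 2 *
            (γ ^ 2 + ‖x‖ ^ 2) ^ (-(5 / 2 : ℝ))) *
          ENNReal.ofReal ((γ ^ 2 + ‖y‖ ^ 2) ^ (-(5 / 2 : ℝ)) * ‖x - y‖ ^ (-(1 : ℝ))) := by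
      intro y
      rw [← ENNReal.ofReal_mul (by positivity), plummerDensity_eq hγ, plummerDensity_eq hγ]
      ring_nf
    have hpow : (γ ^ 2 + ‖x‖ ^ 2) ^ (-(3 : ℝ)) =
        (γ ^ 2 + ‖x‖ ^ 2) ^ (-(5 / 2 : ℝ)) * (γ ^ 2 + ‖x‖ ^ 2) ^ (-(1 / 2 : ℝ)) := by
      rw [← Real.rpow_add (by positivity)]; norm_num
    simp_rw [hsplit]
    rw [lintegral_const_mul' _ _ ENNReal.ofReal_ne_top,
      lintegral_rpow_sq_norm_mul_inv_norm_sub (by positivity),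
      ← ENNReal.ofReal_mul (by positivity), ← ENNReal.ofReal_mul (by positivity), hpow]
    ring_nf
  rw [integral_eq_lintegral_of_nonneg_ae ?_ hmeas.aestronglyMeasurable,
    lintegral_prod _ hmeas.ennreal_ofReal.aemeasurable]
  · simp_rw [hinner]
    rw [lintegral_const_mul' _ _ ENNReal.ofReal_ne_top,
      lintegral_rpow_neg_three_sq_norm (by positivity), h3, ← ENNReal.ofReal_mul (by positivity),
      ENNReal.toReal_ofReal (by positivity)]
    field_simp
    norm_num
  · refine ae_of_all _ fun p ↦ ?_
    simp only [Pi.zero_apply, plummerDensity_eq hγ]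
    positivity

theorem C31_eq : C31 = 8 / 3 * (Real.pi / 2) ^ (-(1 / 3 : ℝ)) := by
  have hpi := Real.pi_pos
  have h32 : Real.Gamma (3 / 2) = 1 / 2 * √Real.pi := by
    rw [show (3 / 2 : ℝ) = 1 / 2 + 1 by norm_num, Real.Gamma_add_one (by norm_num),
      Real.Gamma_one_half_eq]
  have h52 : Real.Gamma (5 / 2) = 3 / 4 * √Real.pi := by
    rw [show (5 / 2 : ℝ) = 3 / 2 + 1 by norm_num, Real.Gamma_add_one (by norm_num), h32]
    ring
  have h3 : Real.Gamma 3 = 2 := by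
    rw [show (3 : ℝ) = 2 + 1 by norm_num, Real.Gamma_add_one (by norm_num), Real.Gamma_two]
    norm_num
  have hroot : 1 / 2 * √Real.pi / 2 = (Real.pi / 2 * (2 : ℝ) ^ (-(3 : ℝ))) ^ (1 / 2 : ℝ) := by
    rw [← Real.sqrt_eq_rpow, show Real.pi / 2 * (2 : ℝ) ^ (-(3 : ℝ)) = Real.pi / 4 ^ 2 by
      rw [Real.rpow_neg (by norm_num)]; norm_num; ring, Real.sqrt_div hpi.le,
      Real.sqrt_sq (by norm_num)]
    ring
  rw [C31, h52, h32, h3, Real.Gamma_one, hroot, ← Real.rpow_mul (by positivity),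
    Real.mul_rpow (by positivity) (by positivity), ← Real.rpow_mul (by norm_num),
    ← Real.sqrt_eq_rpow]
  norm_num
  field_simp
  norm_num

/-- The normalized Plummer density saturates the diagonal
Hardy–Littlewood–Sobolev inequality with `D = 3`, `λ = 1`:
`∬ f(x) f(y) |x−y|^{−1} dx dy = C(3,1) ‖f‖_{6/5}²`, where
`‖f‖_{6/5} = (∫ f^{6/5})^{5/6}`. -/
theorem plummer_saturates_hls (γ : ℝ) (hγ : 0 < γ) :
    ∫ p : EuclideanSpace ℝ (Fin 3) × EuclideanSpace ℝ (Fin 3),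
        plummerDensity γ p.1 * plummerDensity γ p.2 * ‖p.1 - p.2‖ ^ (-(1 : ℝ))
        ∂(volume.prod volume) =
      C31 * ((∫ x, plummerDensity γ x ^ ((6 : ℝ) / 5)) ^ ((5 : ℝ) / 6)) ^ 2 := by
  have hpi := Real.pi_pos
  have hbase : Real.pi ^ 2 / 4 * (γ ^ 3)⁻¹ = (Real.pi / 2) ^ (2 : ℝ) * γ ^ (-(3 : ℝ)) := by
    rw [Real.rpow_neg hγ.le]
    norm_cast
    ring
  have hnorm : ((∫ x, plummerDensity γ x ^ ((6 : ℝ) / 5)) ^ ((5 : ℝ) / 6)) ^ 2 =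
      (3 * γ ^ 2 / (4 * Real.pi)) ^ 2 * ((Real.pi / 2) ^ (10 / 3 : ℝ) * (γ ^ 5)⁻¹) := by
    rw [integral_plummerDensity_rpow hγ, Real.mul_rpow (by positivity) (by positivity),
      ← Real.rpow_mul (by positivity), mul_pow, hbase, ← Real.rpow_natCast (_ ^ (5 / 6 : ℝ)) 2,
      ← Real.rpow_mul (by positivity), Real.mul_rpow (by positivity) (by positivity),
      ← Real.rpow_mul (by positivity), ← Real.rpow_mul hγ.le, ← Real.rpow_natCast γ 5,
      ← Real.rpow_neg hγ.le]
    norm_num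
  have hcube : (Real.pi / 2) ^ (-(1 / 3 : ℝ)) * (Real.pi / 2) ^ (10 / 3 : ℝ) =
      (Real.pi / 2) ^ 3 := by
    rw [← Real.rpow_add (by positivity), ← Real.rpow_natCast]
    norm_num
  rw [integral_plummerDensity_mul_plummerDensity hγ, hnorm, C31_eq]
  calc 3 * Real.pi / (16 * γ)
      = 8 / 3 * (3 * γ ^ 2 / (4 * Real.pi)) ^ 2 * (γ ^ 5)⁻¹ * (Real.pi / 2) ^ 3 := by
        field_simp
        norm_num
    _ = _ := by rw [← hcube]; ring
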